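/- arXiv:math/0602198 — 2 statements merged into one kernel-verified Lean document; each statement's English description precedes it below -/
import Mathlib

section
/- Let n ≥ 1 and let C(X,Y) = Y^3 + a1(X)*Y^2 + a2(X)*Y + a3(X) be a complex polynomial that is totally nondegenerate and whose Newton polygon is the triangle Δ_n with vertices (0,0), (0,3) and (3n,0). Then the discriminant of C with respect to Y has exactly 6n roots in ℂ\{0}, counted with multiplicity. -/
open Polynomial

noncomputable section

/-- The set of exponent vectors `(i, j)` (as points of `ℝ²`) of the monomials
`X^i Y^j` appearing in the two-variable polynomial `C ∈ ℂ[X][Y]`. -/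
def exponentSet (C : Polynomial (Polynomial ℂ)) : Set (ℝ × ℝ) :=
  {p | ∃ i j : ℕ, ((C.coeff j).coeff i ≠ 0) ∧ p = ((i : ℝ), (j : ℝ))}

/-- The Newton polygon of `C ∈ ℂ[X][Y]` : the convex hull of its exponent vectors. -/
def newtonPolygon (C : Polynomial (Polynomial ℂ)) : Set (ℝ × ℝ) :=
  convexHull ℝ (exponentSet C)

/-- `γ` is a face of the convex set `Δ ⊆ ℝ²` : the subset of `Δ` where some linear
functional attains its maximum on `Δ` (a vertex, an edge, or `Δ` itself). -/
def IsFace (Δ γ : Set (ℝ × ℝ)) : Prop :=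
  ∃ u : ℝ × ℝ, γ = {p | p ∈ Δ ∧ ∀ q ∈ Δ, u.1 * q.1 + u.2 * q.2 ≤ u.1 * p.1 + u.2 * p.2}

open Classical in
/-- The truncation of `C ∈ ℂ[X][Y]` on a subset `γ ⊆ ℝ²` : keep only the monomials
whose exponent vector lies in `γ`. -/
def truncation (C : Polynomial (Polynomial ℂ)) (γ : Set (ℝ × ℝ)) :
    Polynomial (Polynomial ℂ) :=
  ∑ j ∈ C.support, Polynomial.monomial j
    (∑ i ∈ (C.coeff j).support,
      if (((i : ℝ), (j : ℝ)) : ℝ × ℝ) ∈ γ then Polynomial.monomial i ((C.coeff j).coeff i)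
      else 0)

/-- Evaluation of `C ∈ ℂ[X][Y]` at a point `(x, y) ∈ ℂ²`. -/
def evalXY (C : Polynomial (Polynomial ℂ)) (x y : ℂ) : ℂ :=
  (C.eval (Polynomial.C y)).eval x

/-- The partial derivative of `C ∈ ℂ[X][Y]` with respect to `X`. -/
def derivX (C : Polynomial (Polynomial ℂ)) : Polynomial (Polynomial ℂ) :=
  ∑ j ∈ C.support, Polynomial.monomial j (Polynomial.derivative (C.coeff j))

/-- `C ∈ ℂ[X][Y]` is totally nondegenerate if the truncation of `C` on any face of
its Newton polygon defines a nonsingular curve in the torus `(ℂ*)²`. -/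
def TotallyNondegenerate (C : Polynomial (Polynomial ℂ)) : Prop :=
  ∀ γ : Set (ℝ × ℝ), IsFace (newtonPolygon C) γ →
    ∀ x y : ℂ, x ≠ 0 → y ≠ 0 →
      ¬(evalXY (truncation C γ) x y = 0 ∧ evalXY (derivX (truncation C γ)) x y = 0 ∧
        evalXY (Polynomial.derivative (truncation C γ)) x y = 0)

lemma coeff_truncation (C : Polynomial (Polynomial ℂ)) (γ : Set (ℝ × ℝ)) (i j : ℕ)
    [Decidable ((((i : ℝ), (j : ℝ)) : ℝ × ℝ) ∈ γ)] :
    ((truncation C γ).coeff j).coeff i =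
      if (((i : ℝ), (j : ℝ)) : ℝ × ℝ) ∈ γ then (C.coeff j).coeff i else 0 := by
  classical
  have key : (truncation C γ).coeff j = ∑ i ∈ (C.coeff j).support,
      if (((i : ℝ), (j : ℝ)) : ℝ × ℝ) ∈ γ then Polynomial.monomial i ((C.coeff j).coeff i)
      else 0 := by
    unfold truncation
    rw [finsetSum_coeff]
    simp only [coeff_monomial]
    rw [Finset.sum_ite_eq']
    split_ifs with h
    · rfl
    · simp [notMem_support_iff.mp h]
  rw [key, finsetSum_coeff]
  have h (k : ℕ) : (if (((k : ℝ), (j : ℝ)) : ℝ × ℝ) ∈ γ then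
      Polynomial.monomial k ((C.coeff j).coeff k) else 0).coeff i =
      if k = i then (if (((i : ℝ), (j : ℝ)) : ℝ × ℝ) ∈ γ then (C.coeff j).coeff i else 0)
      else 0 := by
    split_ifs <;> simp_all [coeff_monomial]
  rw [Finset.sum_congr rfl fun k _ => h k, Finset.sum_ite_eq']
  split_ifs with h₁ h₂ h₂
  · rfl
  · rfl
  · simp [notMem_support_iff.mp h₁]
  · rfl

lemma coeff_derivX (P : Polynomial (Polynomial ℂ)) (j : ℕ) :
    (derivX P).coeff j = derivative (P.coeff j) := by
  unfold derivX
  rw [finsetSum_coeff]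
  simp only [coeff_monomial]
  rw [Finset.sum_ite_eq']
  split_ifs with h
  · rfl
  · simp [notMem_support_iff.mp h]

/-- The monic cubic in `Y` with coefficients `b1`, `b2`, `b3`. -/
def monicCubic {R : Type*} [CommRing R] (b1 b2 b3 : R) : R[X] :=
  X ^ 3 + C b1 * X ^ 2 + C b2 * X + C b3

lemma coeff_monicCubic {R : Type*} [CommRing R] (b1 b2 b3 : R) (j : ℕ) :
    (monicCubic b1 b2 b3).coeff j =
      if j = 0 then b3 else if j = 1 then b2 else if j = 2 then b1 else if j = 3 then 1 else 0 := by
  rcases j with _ | _ | _ | _ | j <;> simp [monicCubic, coeff_X, coeff_X_pow, coeff_C]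

lemma derivX_monicCubic (b1 b2 b3 : ℂ[X]) :
    derivX (monicCubic b1 b2 b3) =
      C (derivative b1) * X ^ 2 + C (derivative b2) * X + C (derivative b3) := by
  ext1 j
  rw [coeff_derivX, coeff_monicCubic]
  rcases j with _ | _ | _ | _ | j <;> simp [coeff_X, coeff_X_pow, coeff_C]

lemma truncation_monicCubic {a1 a2 a3 : ℂ[X]} {γ : Set (ℝ × ℝ)} {b1 b2 b3 : ℂ[X]}
    {e : ℕ → ℕ} (he : e 3 = 0)
    (hγ : ∀ i j : ℕ, ((monicCubic a1 a2 a3).coeff j).coeff i ≠ 0 →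
      ((((i : ℝ), (j : ℝ)) : ℝ × ℝ) ∈ γ ↔ i = e j))
    (h1 : b1 = monomial (e 2) (a1.coeff (e 2))) (h2 : b2 = monomial (e 1) (a2.coeff (e 1)))
    (h3 : b3 = monomial (e 0) (a3.coeff (e 0))) :
    truncation (monicCubic a1 a2 a3) γ = monicCubic b1 b2 b3 := by
  classical
  have h (i j : ℕ) : ((truncation (monicCubic a1 a2 a3) γ).coeff j).coeff i =
      if i = e j then ((monicCubic a1 a2 a3).coeff j).coeff i else 0 := by
    rw [coeff_truncation]
    by_cases h0 : ((monicCubic a1 a2 a3).coeff j).coeff i = 0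
    · simp [h0]
    · simp [hγ i j h0]
  ext j i
  rw [h, coeff_monicCubic, coeff_monicCubic]
  subst h1 h2 h3
  rcases j with _ | _ | _ | _ | j <;> simp [coeff_monomial, coeff_one, he] <;> grind

lemma exists_common_root_of_discr_eq_zero {a b c : ℂ}
    (h : a ^ 2 * b ^ 2 - 4 * b ^ 3 - 4 * a ^ 3 * c + 18 * a * b * c - 27 * c ^ 2 = 0) :
    ∃ y : ℂ, y ^ 3 + a * y ^ 2 + b * y + c = 0 ∧ 3 * y ^ 2 + 2 * a * y + b = 0 := by
  by_cases hp : a ^ 2 - 3 * b = 0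
  · obtain rfl : b = a ^ 2 / 3 := by linear_combination -hp / 3
    have hc : (c - a ^ 3 / 27) ^ 2 = 0 := by linear_combination -h / 27
    have hc' := pow_eq_zero_iff (two_ne_zero) |>.mp hc
    refine ⟨-a / 3, ?_, ?_⟩
    · linear_combination hc'
    · ring
  · have hy : 2 * (a ^ 2 - 3 * b) * ((9 * c - a * b) / (2 * (a ^ 2 - 3 * b))) = 9 * c - a * b := by
      field_simp
    set y := (9 * c - a * b) / (2 * (a ^ 2 - 3 * b))
    have hd : 3 * y ^ 2 + 2 * a * y + b = 0 := by
      have : (2 * (a ^ 2 - 3 * b)) ^ 2 * (3 * y ^ 2 + 2 * a * y + b) = 0 := by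
        linear_combination (3 * (2 * (a ^ 2 - 3 * b) * y + (9 * c - a * b)) +
          4 * a * (a ^ 2 - 3 * b)) * hy - 9 * h
      simpa [hp] using this
    exact ⟨y, by linear_combination (3 * y + a) / 9 * hd - hy / 9, hd⟩

/-- If the truncation of a totally nondegenerate monic cubic to a face consists of the monomials
`X ^ (k * (3 - j)) * Y ^ j`, then the discriminant of its restriction to `X = 1` is nonzero. -/
lemma discr_ne_zero_of_face {a1 a2 a3 : ℂ[X]}
    (hnd : TotallyNondegenerate (monicCubic a1 a2 a3)) (k : ℕ) (u : ℝ × ℝ) (v : ℝ)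
    (hle : ∀ q ∈ newtonPolygon (monicCubic a1 a2 a3), u.1 * q.1 + u.2 * q.2 ≤ v)
    (hv : ∃ q ∈ newtonPolygon (monicCubic a1 a2 a3), u.1 * q.1 + u.2 * q.2 = v)
    (hu : ∀ i j : ℕ, ((monicCubic a1 a2 a3).coeff j).coeff i ≠ 0 →
      (u.1 * i + u.2 * j = v ↔ i = k * (3 - j)))
    {α1 α2 α3 : ℂ} (h1 : a1.coeff k = α1) (h2 : a2.coeff (k * 2) = α2)
    (h3 : a3.coeff (k * 3) = α3) (h0 : α3 ≠ 0) :
    α1 ^ 2 * α2 ^ 2 - 4 * α2 ^ 3 - 4 * α1 ^ 3 * α3 + 18 * α1 * α2 * α3 - 27 * α3 ^ 2 ≠ 0 := by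
  intro hD
  obtain ⟨y, hy, hy'⟩ := exists_common_root_of_discr_eq_zero hD
  have hy0 : y ≠ 0 := by
    rintro rfl
    exact h0 (by simpa using hy)
  refine hnd _ ⟨u, rfl⟩ 1 y one_ne_zero hy0 ?_
  rw [truncation_monicCubic (b1 := monomial k α1) (b2 := monomial (k * 2) α2)
    (b3 := monomial (k * 3) α3) (e := fun j => k * (3 - j)) (by simp) ?_
    (by simp [h1]) (by simp [h2]) (by simp [h3])]
  · rw [derivX_monicCubic]
    refine ⟨?_, ?_, ?_⟩
    · simpa [evalXY, monicCubic, eval_monomial] using hy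
    · simp only [evalXY, derivative_monomial, eval_add, eval_mul, eval_C, eval_pow, eval_X,
        eval_monomial, one_pow, mul_one]
      push_cast
      linear_combination (3 * k : ℂ) * hy - k * y * hy'
    · have : evalXY (derivative (monicCubic (monomial k α1) (monomial (k * 2) α2)
          (monomial (k * 3) α3))) 1 y = 3 * y ^ 2 + 2 * α1 * y + α2 := by
        simp [evalXY, monicCubic, eval_monomial]
        ring
      rw [this, hy']
  · intro i j hij
    rw [← hu i j hij]
    obtain ⟨q, hq, hqv⟩ := hv
    constructor
    · rintro ⟨hm, hmax⟩
      exact le_antisymm (hle _ hm) (hqv ▸ hmax q hq)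
    · intro h
      exact ⟨subset_convexHull ℝ _ ⟨i, j, hij, rfl⟩, fun r hr => h ▸ hle r hr⟩

lemma linear_le_of_mem_convexHull {s : Set (ℝ × ℝ)} {a b v : ℝ}
    (h : ∀ q ∈ s, a * q.1 + b * q.2 ≤ v) {p : ℝ × ℝ} (hp : p ∈ convexHull ℝ s) :
    a * p.1 + b * p.2 ≤ v := by
  have hc : Convex ℝ {q : ℝ × ℝ | a * q.1 + b * q.2 ≤ v} :=
    convex_halfSpace_le (f := fun q : ℝ × ℝ => a * q.1 + b * q.2)
      ⟨fun x y => by simp; ring, fun c x => by simp; ring⟩ v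
  exact convexHull_min h hc hp

/-- `p` has degree at most `d`, and its coefficient in degree `d` is `c`. -/
def HasTop (p : ℂ[X]) (d : ℕ) (c : ℂ) : Prop :=
  p.natDegree ≤ d ∧ p.coeff d = c

lemma HasTop.mul {p q : ℂ[X]} {d e : ℕ} {a b : ℂ} (hp : HasTop p d a) (hq : HasTop q e b) :
    HasTop (p * q) (d + e) (a * b) :=
  ⟨natDegree_mul_le_of_le hp.1 hq.1, by
    rw [coeff_mul_add_eq_of_natDegree_le hp.1 hq.1, hp.2, hq.2]⟩

lemma HasTop.pow {p : ℂ[X]} {d : ℕ} {a : ℂ} (hp : HasTop p d a) (m : ℕ) :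
    HasTop (p ^ m) (m * d) (a ^ m) :=
  ⟨natDegree_pow_le_of_le m hp.1, by rw [coeff_pow_of_natDegree_le hp.1, hp.2]⟩

lemma HasTop.add {p q : ℂ[X]} {d : ℕ} {a b : ℂ} (hp : HasTop p d a) (hq : HasTop q d b) :
    HasTop (p + q) d (a + b) :=
  ⟨natDegree_add_le_of_degree_le hp.1 hq.1, by rw [coeff_add, hp.2, hq.2]⟩

lemma HasTop.sub {p q : ℂ[X]} {d : ℕ} {a b : ℂ} (hp : HasTop p d a) (hq : HasTop q d b) :
    HasTop (p - q) d (a - b) :=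
  ⟨natDegree_sub_le_of_le hp.1 hq.1 |>.trans (max_self d).le, by rw [coeff_sub, hp.2, hq.2]⟩

lemma hasTop_ofNat (m : ℕ) [m.AtLeastTwo] : HasTop (ofNat(m) : ℂ[X]) 0 (ofNat(m) : ℂ) :=
  ⟨(natDegree_ofNat m).le, by simp⟩

lemma HasTop.discr {a1 a2 a3 : ℂ[X]} {n : ℕ} {α1 α2 α3 : ℂ} (h1 : HasTop a1 n α1)
    (h2 : HasTop a2 (n * 2) α2) (h3 : HasTop a3 (n * 3) α3) :
    HasTop (a1 ^ 2 * a2 ^ 2 - 4 * a2 ^ 3 - 4 * a1 ^ 3 * a3 + 18 * a1 * a2 * a3 - 27 * a3 ^ 2)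
      (6 * n) (α1 ^ 2 * α2 ^ 2 - 4 * α2 ^ 3 - 4 * α1 ^ 3 * α3 + 18 * α1 * α2 * α3
        - 27 * α3 ^ 2) := by
  refine ((((?_ : HasTop _ _ _).sub ?_).sub ?_).add ?_).sub ?_
  · convert (h1.pow 2).mul (h2.pow 2) using 1; ring
  · convert (hasTop_ofNat 4).mul (h2.pow 3) using 1; ring
  · convert ((hasTop_ofNat 4).mul (h1.pow 3)).mul h3 using 1; ring
  · convert (((hasTop_ofNat 18).mul h1).mul h2).mul h3 using 1; ring
  · convert (hasTop_ofNat 27).mul (h3.pow 2) using 1; ring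

/-- **Corollary.** Let `n ≥ 1` and let `C(X,Y) = Y^3 + a1(X) Y^2 + a2(X) Y + a3(X)`
be a totally nondegenerate complex polynomial whose Newton polygon is the triangle
`Δ_n` with vertices `(0,0)`, `(0,3)` and `(3n,0)`. Then the discriminant of `C` with
respect to `Y` has exactly `6n` roots in `ℂ*`, counted with multiplicity. -/
theorem trigonal_discriminant_roots_count (n : ℕ) (hn : 1 ≤ n)
    (a1 a2 a3 : Polynomial ℂ) (C : Polynomial (Polynomial ℂ))
    (hC : C = Polynomial.X ^ 3 + Polynomial.C a1 * Polynomial.X ^ 2 +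
      Polynomial.C a2 * Polynomial.X + Polynomial.C a3)
    (hNP : newtonPolygon C =
      convexHull ℝ {((0 : ℝ), (0 : ℝ)), ((0 : ℝ), (3 : ℝ)), ((3 * n : ℝ), (0 : ℝ))})
    (hnd : TotallyNondegenerate C)
    (D : Polynomial ℂ)
    (hD : D = a1 ^ 2 * a2 ^ 2 - 4 * a2 ^ 3 - 4 * a1 ^ 3 * a3 + 18 * a1 * a2 * a3
      - 27 * a3 ^ 2) :
    Multiset.card (D.roots.filter fun z => z ≠ 0) = 6 * n := by
  have hC' : C = monicCubic a1 a2 a3 := hC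
  subst hC'
  clear hC
  have hn' : (1 : ℝ) ≤ n := by exact_mod_cast hn
  have hvert {p : ℝ × ℝ} (hp : p ∈ ({((0 : ℝ), (0 : ℝ)), ((0 : ℝ), (3 : ℝ)),
      ((3 * n : ℝ), (0 : ℝ))} : Set (ℝ × ℝ))) : p ∈ newtonPolygon (monicCubic a1 a2 a3) :=
    hNP ▸ subset_convexHull ℝ _ hp
  have h00 : ((0 : ℝ), (0 : ℝ)) ∈ newtonPolygon (monicCubic a1 a2 a3) := hvert (by simp)
  have h30 : ((3 * n : ℝ), (0 : ℝ)) ∈ newtonPolygon (monicCubic a1 a2 a3) := hvert (by simp)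
  have hup : ∀ q ∈ newtonPolygon (monicCubic a1 a2 a3), 1 * q.1 + (n : ℝ) * q.2 ≤ 3 * n := by
    intro q hq
    rw [hNP] at hq
    refine linear_le_of_mem_convexHull ?_ hq
    rintro p (rfl | rfl | rfl) <;> grind
  have hleft : ∀ q ∈ newtonPolygon (monicCubic a1 a2 a3), -1 * q.1 + 0 * q.2 ≤ 0 := by
    intro q hq
    rw [hNP] at hq
    refine linear_le_of_mem_convexHull ?_ hq
    rintro p (rfl | rfl | rfl) <;> simp
  have hcoeff (i j : ℕ) (hij : ((monicCubic a1 a2 a3).coeff j).coeff i ≠ 0) :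
      i + n * j ≤ 3 * n := by
    have := hup _ (subset_convexHull ℝ _ ⟨i, j, hij, rfl⟩)
    simp only [one_mul] at this
    exact_mod_cast this
  have hj (i j : ℕ) (hij : ((monicCubic a1 a2 a3).coeff j).coeff i ≠ 0) : j ≤ 3 :=
    Nat.le_of_mul_le_mul_left (by linarith [hcoeff i j hij] : n * j ≤ n * 3) hn
  have hzero : a3.coeff 0 ≠ 0 := by
    intro h
    have := linear_le_of_mem_convexHull (a := -1) (b := -1) (v := -1) ?_ h00
    · norm_num at this
    · rintro _ ⟨i, j, hij, rfl⟩
      have : 1 ≤ i + j := by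
        by_contra hlt
        obtain ⟨rfl, rfl⟩ : i = 0 ∧ j = 0 := by omega
        simp [coeff_monicCubic, h] at hij
      have : (1 : ℝ) ≤ i + j := by exact_mod_cast this
      simp only
      linarith
  have htop : a3.coeff (n * 3) ≠ 0 := by
    intro h
    have := linear_le_of_mem_convexHull (a := 1) (b := 0) (v := 3 * n - 1) ?_ h30
    · norm_num at this
    · rintro _ ⟨i, j, hij, rfl⟩
      have : i + 1 ≤ 3 * n := by
        have h' := hcoeff i j hij
        rcases Nat.eq_zero_or_pos j with rfl | hpos
        · rcases eq_or_ne i (n * 3) with rfl | hne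
          · simp [coeff_monicCubic, h] at hij
          · omega
        · nlinarith
      have : (i : ℝ) + 1 ≤ 3 * n := by exact_mod_cast this
      simp only
      linarith
  have hd {p : ℂ[X]} {j d : ℕ} (hp : (monicCubic a1 a2 a3).coeff j = p)
      (hd : n * j + d = 3 * n) : HasTop p d (p.coeff d) := by
    refine ⟨natDegree_le_iff_coeff_eq_zero.mpr fun i hi => ?_, rfl⟩
    by_contra hne
    have := hcoeff i j (hp ▸ hne)
    omega
  have hDtop : HasTop D (6 * n) _ := hD ▸ HasTop.discr
    (hd (j := 2) (by simp [coeff_monicCubic]) (by ring))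
    (hd (j := 1) (by simp [coeff_monicCubic]) (by ring))
    (hd (j := 0) (by simp [coeff_monicCubic]) (by ring))
  have hdeg : D.natDegree = 6 * n := by
    refine natDegree_eq_of_le_of_coeff_ne_zero hDtop.1 ?_
    rw [hDtop.2]
    refine discr_ne_zero_of_face hnd n (1, n) (3 * n) hup ⟨_, h30, by simp⟩ ?_ rfl rfl rfl htop
    intro i j hij
    have h3 := hj i j hij
    rw [one_mul, ← Nat.cast_inj (R := ℝ)]
    push_cast [Nat.cast_sub h3]
    constructor <;> intro h <;> linarith
  have hroot : ¬ D.IsRoot 0 := by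
    have := discr_ne_zero_of_face hnd 0 (-1, 0) 0 hleft ⟨_, h00, by simp⟩ (by simp) rfl rfl rfl
      (by simpa using hzero)
    simpa [hD, coeff_zero_eq_eval_zero] using this
  rw [Multiset.filter_eq_self.mpr, IsAlgClosed.card_roots_eq_natDegree, hdeg]
  rintro z hz rfl
  exact hroot (isRoot_of_mem_roots hz)


end
end

section
/- Let Δ be a convex polygon in ℝ^2 with vertices in ℤ^2 and with nonempty interior (i.e. dim Δ = 2). Then the moment map μ_Δ : (0,∞)^2 → int(Δ) defined by μ_Δ(x,y) = ( Σ_{(i,j)∈Δ∩ℤ^2} x^i y^j (i,j) ) / ( Σ_{(i,j)∈Δ∩ℤ^2} x^i y^j ) is a bijection from (0,∞)^2 onto the interior of Δ. -/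
section ExponentialFamily

variable {ι E : Type*} [NormedAddCommGroup E] [NormedSpace ℝ E]

/-- The barycentre of the points `v i`, `i ∈ s`, with the exponential weights `exp (ξ (v i))`. -/
noncomputable def expBarycenter (s : Finset ι) (v : ι → E) (ξ : StrongDual ℝ E) : E :=
  s.centerMass (fun i => Real.exp (ξ (v i))) v

theorem centerMass_eq_iff_sum_smul_sub_eq_zero {s : Finset ι} {w : ι → ℝ} {v : ι → E} {q : E}
    (hw : ∑ i ∈ s, w i ≠ 0) : s.centerMass w v = q ↔ ∑ i ∈ s, w i • (v i - q) = 0 := by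
  rw [Finset.centerMass, inv_smul_eq_iff₀ hw]
  simp only [smul_sub, Finset.sum_sub_distrib, ← Finset.sum_smul, sub_eq_zero]

theorem nonempty_of_interior_convexHull_image {s : Finset ι} {v : ι → E}
    (h : (interior (convexHull ℝ (v '' s))).Nonempty) : s.Nonempty := by
  have := h.mono interior_subset
  rwa [convexHull_nonempty_iff, Set.image_nonempty, Finset.coe_nonempty] at this

theorem sum_exp_pos {s : Finset ι} (hs : s.Nonempty) (f : ι → ℝ) :
    0 < ∑ i ∈ s, Real.exp (f i) :=
  Finset.sum_pos (fun _ _ => Real.exp_pos _) hs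

theorem expBarycenter_eq_iff {s : Finset ι} {v : ι → E}
    (hs : s.Nonempty) {ξ : StrongDual ℝ E} {q : E} :
    expBarycenter s v ξ = q ↔ ∑ i ∈ s, Real.exp (ξ (v i)) • (v i - q) = 0 :=
  centerMass_eq_iff_sum_smul_sub_eq_zero (sum_exp_pos hs _).ne'

theorem le_of_mem_convexHull_image {s : Finset ι} {v : ι → E} (f : StrongDual ℝ E) {c : ℝ}
    (h : ∀ i ∈ s, f (v i) ≤ c) {z : E} (hz : z ∈ convexHull ℝ (v '' s)) : f z ≤ c := by
  refine convexHull_min (t := {z | f z ≤ c}) ?_ (convex_halfSpace_le f.isLinear c) hz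
  rintro _ ⟨i, hi, rfl⟩
  exact h i hi

/-- A functional that is constant on a set of points whose convex hull has nonempty interior
vanishes. -/
theorem eq_zero_of_const_of_interior_convexHull {s : Finset ι} {v : ι → E}
    (h : (interior (convexHull ℝ (v '' s))).Nonempty) (f : StrongDual ℝ E) {c : ℝ}
    (hf : ∀ i ∈ s, f (v i) = c) : f = 0 := by
  obtain ⟨a, ha⟩ := h
  have hconst : ∀ z ∈ convexHull ℝ (v '' s), f z = c := fun z hz =>
    le_antisymm (le_of_mem_convexHull_image f (fun i hi => (hf i hi).le) hz) <| by
      have := le_of_mem_convexHull_image (-f) (c := -c) (fun i hi => by simp [hf i hi]) hz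
      simpa using this
  have hloc : f =ᶠ[nhds a] fun _ => c := by
    filter_upwards [isOpen_interior.mem_nhds ha] with z hz
    exact hconst z (interior_subset hz)
  exact f.hasFDerivAt.unique ((hasFDerivAt_const c a).congr_of_eventuallyEq hloc)

theorem expBarycenter_mem_interior {s : Finset ι} {v : ι → E}
    (h : (interior (convexHull ℝ (v '' s))).Nonempty) (ξ : StrongDual ℝ E) :
    expBarycenter s v ξ ∈ interior (convexHull ℝ (v '' s)) := by
  have hs := nonempty_of_interior_convexHull_image h
  set m := expBarycenter s v ξ with hm
  have hconv := convex_convexHull ℝ (v '' (s : Set ι))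
  by_contra hmem
  obtain ⟨f, hf⟩ := geometric_hahn_banach_open_point hconv.interior isOpen_interior hmem
  have hle : ∀ i ∈ s, f (v i) ≤ f m := fun i hi => by
    have hcl : v i ∈ closure (interior (convexHull ℝ (v '' (s : Set ι)))) := by
      rw [hconv.closure_interior_eq_closure_of_nonempty_interior h]
      exact subset_closure (subset_convexHull ℝ _ ⟨i, hi, rfl⟩)
    exact closure_minimal (t := {z | f z ≤ f m}) (fun z hz => (hf z hz).le)
      (isClosed_le f.continuous continuous_const) hcl
  have hsum : ∑ i ∈ s, Real.exp (ξ (v i)) * (f m - f (v i)) = 0 := by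
    have := congrArg (fun z => -f z) ((expBarycenter_eq_iff hs).1 hm.symm)
    simpa [← Finset.sum_neg_distrib, ← mul_neg] using this
  rw [Finset.sum_eq_zero_iff_of_nonneg
    fun i hi => mul_nonneg (Real.exp_pos _).le (sub_nonneg.2 (hle i hi))] at hsum
  have hf0 : f = 0 := eq_zero_of_const_of_interior_convexHull h f (c := f m) fun i hi => by
    have := (mul_eq_zero.1 (hsum i hi)).resolve_left (Real.exp_pos _).ne'
    linarith
  obtain ⟨a, ha⟩ := h
  simpa [hf0] using hf a ha

theorem expBarycenter_injective {s : Finset ι} {v : ι → E}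
    (h : (interior (convexHull ℝ (v '' s))).Nonempty) :
    Function.Injective (expBarycenter s v) := by
  intro ξ ζ heq
  have hs := nonempty_of_interior_convexHull_image h
  set q := expBarycenter s v ζ with hq
  have hξ := congrArg (ξ - ζ) ((expBarycenter_eq_iff hs).1 heq)
  have hζ := congrArg (ξ - ζ) ((expBarycenter_eq_iff hs).1 hq.symm)
  simp only [map_sum, map_smul, map_zero, smul_eq_mul] at hξ hζ
  have hsum : ∑ i ∈ s, (Real.exp (ξ (v i - q)) - Real.exp (ζ (v i - q))) *
      (ξ - ζ) (v i - q) = 0 := by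
    calc _ = Real.exp (-ξ q) * ∑ i ∈ s, Real.exp (ξ (v i)) * (ξ - ζ) (v i - q) -
          Real.exp (-ζ q) * ∑ i ∈ s, Real.exp (ζ (v i)) * (ξ - ζ) (v i - q) := by
          rw [Finset.mul_sum, Finset.mul_sum, ← Finset.sum_sub_distrib]
          refine Finset.sum_congr rfl fun i _ => ?_
          rw [map_sub ξ, map_sub ζ, sub_eq_add_neg (ξ (v i)), sub_eq_add_neg (ζ (v i)),
            Real.exp_add, Real.exp_add]
          ring
      _ = 0 := by rw [hξ, hζ]; simp
  have hnonneg : ∀ a b : ℝ, 0 ≤ (Real.exp a - Real.exp b) * (a - b) := fun a b => by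
    rcases le_total a b with hab | hab
    · exact mul_nonneg_of_nonpos_of_nonpos (sub_nonpos.2 (Real.exp_le_exp.2 hab))
        (sub_nonpos.2 hab)
    · exact mul_nonneg (sub_nonneg.2 (Real.exp_le_exp.2 hab)) (sub_nonneg.2 hab)
  replace hsum := (Finset.sum_eq_zero_iff_of_nonneg fun i _ =>
    hnonneg (ξ (v i - q)) (ζ (v i - q))).1 hsum
  refine sub_eq_zero.1 <|
    eq_zero_of_const_of_interior_convexHull h (ξ - ζ) (c := (ξ - ζ) q) fun i hi => ?_
  rw [← sub_eq_zero, ← map_sub]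
  rcases mul_eq_zero.1 (hsum i hi) with h0 | h0
  · rw [sub_apply, Real.exp_injective (sub_eq_zero.1 h0), sub_self]
  · exact h0

theorem tendsto_sum_exp_cocompact [FiniteDimensional ℝ E] {s : Finset ι} {v : ι → E} {q : E}
    (hq : q ∈ interior (convexHull ℝ (v '' s))) :
    Filter.Tendsto (fun ξ : StrongDual ℝ E => ∑ i ∈ s, Real.exp (ξ (v i - q)))
      (Filter.cocompact _) Filter.atTop := by
  obtain ⟨r, hr, hball⟩ :=
    Metric.nhds_basis_closedBall.mem_iff.1 (mem_interior_iff_mem_nhds.1 hq)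
  have hbound : ∀ ξ : StrongDual ℝ E, ‖ξ‖ * r ≤ ∑ i ∈ s, Real.exp (ξ (v i - q)) := fun ξ => by
    set F := ∑ i ∈ s, Real.exp (ξ (v i - q)) with hF
    have hle : ∀ u, ‖u‖ ≤ r → ξ u ≤ F := fun u hu => by
      have := le_of_mem_convexHull_image ξ (c := F + ξ q) (fun i hi => by
        have h1 : ξ (v i - q) ≤ F := ((le_add_of_nonneg_right zero_le_one).trans
          (Real.add_one_le_exp _)).trans
          (Finset.single_le_sum (f := fun i => Real.exp (ξ (v i - q)))
            (fun _ _ => (Real.exp_pos _).le) hi)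
        rw [map_sub] at h1
        linarith) (hball (show q + u ∈ Metric.closedBall q r by simpa using hu))
      rw [map_add] at this
      linarith
    rw [← le_div_iff₀ hr]
    refine ContinuousLinearMap.opNorm_bound_of_ball_bound hr F ξ fun u hu => ?_
    rw [mem_closedBall_zero_iff] at hu
    refine abs_le.2 ⟨?_, hle u hu⟩
    have := hle (-u) (by rwa [norm_neg])
    rw [map_neg] at this
    linarith
  exact Filter.tendsto_atTop_mono hbound
    ((tendsto_norm_cocompact_atTop (E := StrongDual ℝ E)).atTop_mul_const hr)

theorem exists_expBarycenter_eq [FiniteDimensional ℝ E] {s : Finset ι} {v : ι → E} {q : E}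
    (hq : q ∈ interior (convexHull ℝ (v '' s))) : ∃ ξ, expBarycenter s v ξ = q := by
  have hs := nonempty_of_interior_convexHull_image ⟨q, hq⟩
  obtain ⟨ξ, hξ⟩ := Continuous.exists_forall_le
    (f := fun ξ : StrongDual ℝ E => ∑ i ∈ s, Real.exp (ξ (v i - q))) (by fun_prop)
    (tendsto_sum_exp_cocompact hq)
  refine ⟨ξ, (expBarycenter_eq_iff hs).2 ?_⟩
  have hzero : ∑ i ∈ s, Real.exp (ξ (v i - q)) • (v i - q) = 0 := by
    refine SeparatingDual.eq_zero_of_forall_dual_eq_zero (R := ℝ) fun η => ?_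
    have hderiv : HasDerivAt (fun t : ℝ => ∑ i ∈ s, Real.exp ((ξ + t • η) (v i - q)))
        (∑ i ∈ s, Real.exp (ξ (v i - q)) * η (v i - q)) 0 := by
      refine HasDerivAt.fun_sum fun i _ => ?_
      have hlin : HasDerivAt (fun t : ℝ => ξ (v i - q) + t * η (v i - q)) (η (v i - q)) 0 := by
        simpa using ((hasDerivAt_id (0 : ℝ)).mul_const (η (v i - q))).const_add (ξ (v i - q))
      simpa using hlin.exp
    have hmin : IsLocalMin (fun t : ℝ => ∑ i ∈ s, Real.exp ((ξ + t • η) (v i - q))) 0 :=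
      Filter.Eventually.of_forall fun t => by simpa using hξ (ξ + t • η)
    simpa using hmin.hasDerivAt_eq_zero hderiv
  have hscale := congrArg (Real.exp (ξ q) • ·) hzero
  simpa [Finset.smul_sum, smul_smul, ← Real.exp_add] using hscale

/-- The interior of the convex hull of finitely many points is parametrized bijectively by the
barycentres with exponential weights. -/
theorem expBarycenter_bijOn [FiniteDimensional ℝ E] {s : Finset ι} {v : ι → E}
    (h : (interior (convexHull ℝ (v '' s))).Nonempty) :
    Set.BijOn (expBarycenter s v) Set.univ (interior (convexHull ℝ (v '' s))) :=
  ⟨fun ξ _ => expBarycenter_mem_interior h ξ, (expBarycenter_injective h).injOn,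
    fun _ hq => (exists_expBarycenter_eq hq).imp fun _ hξ => ⟨Set.mem_univ _, hξ⟩⟩

end ExponentialFamily

/-- The functional `(a, b) ↦ a log x + b log y`. -/
noncomputable def logFunctional (xy : ℝ × ℝ) : StrongDual ℝ (ℝ × ℝ) :=
  Real.log xy.1 • ContinuousLinearMap.fst ℝ ℝ ℝ + Real.log xy.2 • ContinuousLinearMap.snd ℝ ℝ ℝ

theorem logFunctional_bijOn :
    Set.BijOn logFunctional (Set.Ioi (0 : ℝ) ×ˢ Set.Ioi (0 : ℝ)) Set.univ := by
  refine ⟨fun _ _ => Set.mem_univ _, ?_, fun ξ _ => ?_⟩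
  · rintro ⟨x, y⟩ ⟨hx, hy⟩ ⟨x', y'⟩ ⟨hx', hy'⟩ heq
    have h1 := DFunLike.congr_fun heq (1, 0)
    have h2 := DFunLike.congr_fun heq (0, 1)
    simp only [logFunctional, add_apply, smul_apply,
      ContinuousLinearMap.coe_fst', ContinuousLinearMap.coe_snd', smul_eq_mul, mul_one, mul_zero,
      add_zero, zero_add] at h1 h2
    exact Prod.ext (Real.log_injOn_pos hx hx' h1) (Real.log_injOn_pos hy hy' h2)
  · refine ⟨(Real.exp (ξ (1, 0)), Real.exp (ξ (0, 1))), ⟨Real.exp_pos _, Real.exp_pos _⟩, ?_⟩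
    ext <;> simp [logFunctional]

theorem exp_logFunctional {xy : ℝ × ℝ} (hxy : xy ∈ Set.Ioi (0 : ℝ) ×ˢ Set.Ioi (0 : ℝ))
    (p : ℤ × ℤ) :
    Real.exp (logFunctional xy ((p.1 : ℝ), (p.2 : ℝ))) = xy.1 ^ p.1 * xy.2 ^ p.2 := by
  simp only [logFunctional, add_apply, smul_apply,
    ContinuousLinearMap.coe_fst', ContinuousLinearMap.coe_snd', smul_eq_mul]
  rw [Real.exp_add, ← Real.rpow_def_of_pos hxy.1, ← Real.rpow_def_of_pos hxy.2,
    Real.rpow_intCast, Real.rpow_intCast]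

/-- Let `Δ` be a convex polygon in `ℝ²` with vertices in `ℤ²` and with nonempty
interior, and let `L` be the (finite) set of integer points of `Δ`. Then the moment
map `μ_Δ(x,y) = (Σ_{(i,j)∈Δ∩ℤ²} x^i y^j (i,j)) / (Σ_{(i,j)∈Δ∩ℤ²} x^i y^j)` is a
bijection from `(0,∞)²` onto the interior of `Δ`. -/
theorem moment_map_bijective (V : Finset (ℤ × ℤ)) (Δ : Set (ℝ × ℝ))
    (hΔ : Δ = convexHull ℝ ((fun p : ℤ × ℤ => ((p.1 : ℝ), (p.2 : ℝ))) '' ↑V))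
    (hdim : (interior Δ).Nonempty)
    (L : Finset (ℤ × ℤ)) (hL : ∀ p : ℤ × ℤ, p ∈ L ↔ ((p.1 : ℝ), (p.2 : ℝ)) ∈ Δ) :
    Set.BijOn
      (fun xy : ℝ × ℝ =>
        (∑ p ∈ L, xy.1 ^ p.1 * xy.2 ^ p.2)⁻¹ •
          ∑ p ∈ L, (xy.1 ^ p.1 * xy.2 ^ p.2) • (((p.1 : ℝ), (p.2 : ℝ)) : ℝ × ℝ))
      (Set.Ioi (0 : ℝ) ×ˢ Set.Ioi (0 : ℝ)) (interior Δ) := by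
  have hhull : Δ = convexHull ℝ ((fun p : ℤ × ℤ => ((p.1 : ℝ), (p.2 : ℝ))) '' ↑L) := by
    refine subset_antisymm ?_ (convexHull_min ?_ (hΔ ▸ convex_convexHull ℝ _))
    · conv_lhs => rw [hΔ]
      refine convexHull_mono (Set.image_mono fun p hp => (hL p).2 ?_)
      exact hΔ ▸ subset_convexHull ℝ _ ⟨p, hp, rfl⟩
    · rintro _ ⟨p, hp, rfl⟩
      exact (hL p).1 hp
  rw [hhull] at hdim ⊢
  refine ((expBarycenter_bijOn hdim).comp logFunctional_bijOn).congr fun xy hxy => ?_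
  simp only [Function.comp_apply, expBarycenter, Finset.centerMass, exp_logFunctional hxy]
end
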